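/- Let n ≥ 1, let p⃗, s⃗ be n-tuples with 1 ≤ pᵢ, sᵢ ≤ ∞ and let 1 ≤ α ≤ ∞. The space (L^{p⃗},L^{s⃗})^α(ℝⁿ) is nontrivial (i.e., contains a function that is not almost everywhere zero) if and only if (1/n)Σᵢ₌₁ⁿ 1/sᵢ ≤ 1/α ≤ (1/n)Σᵢ₌₁ⁿ 1/pᵢ. -/

import Mathlib

open MeasureTheory ENNReal Filter Topology Set

noncomputable section

namespace MixedAmalgam

/-- `L^p` norm over `ℝ` of an `ℝ≥0∞`-valued function, with the usual
modification (`essSup`) for `p = ∞`. -/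
def lpInt (p : ℝ≥0∞) (g : ℝ → ℝ≥0∞) : ℝ≥0∞ :=
  if p = ∞ then essSup g volume else (∫⁻ t, g t ^ p.toReal) ^ (1 / p.toReal)

/-- `ℓ^p` norm over `ℤ` of an `ℝ≥0∞`-valued family, with the usual
modification for `p = ∞`. -/
def lpSum (p : ℝ≥0∞) (g : ℤ → ℝ≥0∞) : ℝ≥0∞ :=
  if p = ∞ then ⨆ k, g k else (∑' k, g k ^ p.toReal) ^ (1 / p.toReal)

/-- Iterated mixed Lebesgue norm of an `ℝ≥0∞`-valued function on `ℝⁿ`,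
taking the `L^{p₁}` norm in the first variable innermost, and the `L^{pₙ}`
norm in the last variable outermost. -/
def mixedE : (n : ℕ) → (Fin n → ℝ≥0∞) → ((Fin n → ℝ) → ℝ≥0∞) → ℝ≥0∞
  | 0, _, g => g Fin.elim0
  | n + 1, p, g =>
    lpInt (p (Fin.last n)) fun t =>
      mixedE n (fun i => p i.castSucc) fun x => g (Fin.snoc x t)

/-- Mixed-norm Lebesgue norm `‖f‖_{L^{p⃗}}` of a real-valued function on `ℝⁿ`. -/
def mixedLp (n : ℕ) (p : Fin n → ℝ≥0∞) (f : (Fin n → ℝ) → ℝ) : ℝ≥0∞ :=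
  mixedE n p fun x => (‖f x‖₊ : ℝ≥0∞)

/-- Iterated mixed `ℓ^{s⃗}` norm of an `ℝ≥0∞`-valued family indexed by `ℤⁿ`. -/
def mixedSeq : (n : ℕ) → (Fin n → ℝ≥0∞) → ((Fin n → ℤ) → ℝ≥0∞) → ℝ≥0∞
  | 0, _, a => a Fin.elim0
  | n + 1, s, a =>
    lpSum (s (Fin.last n)) fun k =>
      mixedSeq n (fun i => s i.castSucc) fun m => a (Fin.snoc m k)

/-- Open Euclidean ball of center `y` and radius `r` in `ℝⁿ`. -/
def eball (n : ℕ) (y : Fin n → ℝ) (r : ℝ) : Set (Fin n → ℝ) :=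
  {x | Real.sqrt (∑ i, (x i - y i) ^ 2) < r}

/-- `Σᵢ 1/pᵢ` as a real number. -/
def invSum (n : ℕ) (p : Fin n → ℝ≥0∞) : ℝ :=
  ∑ i, (1 / p i).toReal

/-- The `(L^{p⃗},L^{s⃗})` amalgam norm computed with balls of radius `r`. -/
def amalgamNormR (n : ℕ) (p s : Fin n → ℝ≥0∞) (r : ℝ) (f : (Fin n → ℝ) → ℝ) : ℝ≥0∞ :=
  mixedE n s fun y => mixedLp n p ((eball n y r).indicator f)

/-- The amalgam norm `‖f‖_{(L^{p⃗},L^{s⃗})}`. -/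
def amalgamNorm (n : ℕ) (p s : Fin n → ℝ≥0∞) (f : (Fin n → ℝ) → ℝ) : ℝ≥0∞ :=
  amalgamNormR n p s 1 f

/-- The amalgam norm `‖f‖_{(L^{p⃗},L^{s⃗})^α}`. -/
def amalgamNormA (n : ℕ) (p s : Fin n → ℝ≥0∞) (α : ℝ≥0∞) (f : (Fin n → ℝ) → ℝ) : ℝ≥0∞ :=
  ⨆ (r : ℝ) (_ : 0 < r),
    mixedE n s fun y =>
      volume (eball n y r) ^
          ((1 / α).toReal - invSum n p / (n : ℝ) - invSum n s / (n : ℝ)) *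
        mixedLp n p ((eball n y r).indicator f)

/-- The amalgam norm `‖·‖_{(L^{p⃗},L^{s⃗})^α}` for `ℝ≥0∞`-valued functions. -/
def amalgamNormAE (n : ℕ) (p s : Fin n → ℝ≥0∞) (α : ℝ≥0∞)
    (g : (Fin n → ℝ) → ℝ≥0∞) : ℝ≥0∞ :=
  ⨆ (r : ℝ) (_ : 0 < r),
    mixedE n s fun y =>
      volume (eball n y r) ^
          ((1 / α).toReal - invSum n p / (n : ℝ) - invSum n s / (n : ℝ)) *
        mixedE n p ((eball n y r).indicator g)

/-- The cube `Q_{r,k} = r(k + [0,1)ⁿ)`. -/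
def qcube (n : ℕ) (r : ℝ) (k : Fin n → ℤ) : Set (Fin n → ℝ) :=
  {x | ∀ i, r * (k i : ℝ) ≤ x i ∧ x i < r * ((k i : ℝ) + 1)}

/-- The discrete amalgam norm `_r‖f‖_{p⃗,s⃗}`. -/
def discNormR (n : ℕ) (p s : Fin n → ℝ≥0∞) (r : ℝ) (f : (Fin n → ℝ) → ℝ) : ℝ≥0∞ :=
  mixedSeq n s fun k => mixedLp n p ((qcube n r k).indicator f)

/-- The discrete amalgam norm `‖f‖_{p⃗,s⃗} = _1‖f‖_{p⃗,s⃗}`. -/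
def discNorm (n : ℕ) (p s : Fin n → ℝ≥0∞) (f : (Fin n → ℝ) → ℝ) : ℝ≥0∞ :=
  discNormR n p s 1 f

/-- The discrete amalgam norm
`‖f‖_{p⃗,s⃗,α} = sup_{r>0} r^{n/α - Σᵢ 1/pᵢ} · _r‖f‖_{p⃗,s⃗}`. -/
def discNormA (n : ℕ) (p s : Fin n → ℝ≥0∞) (α : ℝ≥0∞) (f : (Fin n → ℝ) → ℝ) : ℝ≥0∞ :=
  ⨆ (r : ℝ) (_ : 0 < r),
    ENNReal.ofReal (r ^ ((n : ℝ) * (1 / α).toReal - invSum n p)) * discNormR n p s r f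

/-- Membership in `(L^{p⃗},L^{s⃗})^α(ℝⁿ)` (continuous form). -/
def memA (n : ℕ) (p s : Fin n → ℝ≥0∞) (α : ℝ≥0∞) (f : (Fin n → ℝ) → ℝ) : Prop :=
  LocallyIntegrable f volume ∧ amalgamNormA n p s α f < ∞

/-- Membership in `(L^{p⃗},ℓ^{s⃗})(ℝⁿ)`. -/
def memD (n : ℕ) (p s : Fin n → ℝ≥0∞) (f : (Fin n → ℝ) → ℝ) : Prop :=
  LocallyIntegrable f volume ∧ discNorm n p s f < ∞

/-- Membership in `(L^{p⃗},ℓ^{s⃗})^α(ℝⁿ)`. -/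
def memDA (n : ℕ) (p s : Fin n → ℝ≥0∞) (α : ℝ≥0∞) (f : (Fin n → ℝ) → ℝ) : Prop :=
  LocallyIntegrable f volume ∧ discNormA n p s α f < ∞

/-- The dilation `St_r^{(α)} f = r^{-n/α} f(r⁻¹ ·)`. -/
def dil (n : ℕ) (α : ℝ≥0∞) (r : ℝ) (f : (Fin n → ℝ) → ℝ) : (Fin n → ℝ) → ℝ :=
  fun x => r ^ (-((n : ℝ) * (1 / α).toReal)) * f (r⁻¹ • x)

/-- A block decomposition `f = Σ_j c_j St_{r_j}^{(α')} f_j` converging in `L¹_loc`. -/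
structure BlockDecomp (n : ℕ) (p' s' : Fin n → ℝ≥0∞) (α' : ℝ≥0∞) (f : (Fin n → ℝ) → ℝ)
    (c : ℕ → ℝ) (rr : ℕ → ℝ) (g : ℕ → (Fin n → ℝ) → ℝ) : Prop where
  csummable : Summable fun j => |c j|
  rpos : ∀ j, 0 < rr j
  gloc : ∀ j, LocallyIntegrable (g j) volume
  gnorm : ∀ j, discNorm n p' s' (g j) ≤ 1
  conv : ∀ K : Set (Fin n → ℝ), IsCompact K →
    Tendsto (fun J : ℕ =>
        ∫⁻ x in K,
          (‖f x - ∑ j ∈ Finset.range J, c j * dil n α' (rr j) (g j) x‖₊ : ℝ≥0∞))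
      atTop (𝓝 0)

/-- Membership in the block space `H(p⃗',s⃗',α')`. -/
def memH (n : ℕ) (p' s' : Fin n → ℝ≥0∞) (α' : ℝ≥0∞) (f : (Fin n → ℝ) → ℝ) : Prop :=
  LocallyIntegrable f volume ∧ ∃ c rr g, BlockDecomp n p' s' α' f c rr g

/-- The norm of the block space `H(p⃗',s⃗',α')`. -/
def hNorm (n : ℕ) (p' s' : Fin n → ℝ≥0∞) (α' : ℝ≥0∞) (f : (Fin n → ℝ) → ℝ) : ℝ≥0∞ :=
  ⨅ (c : ℕ → ℝ) (rr : ℕ → ℝ) (g : ℕ → (Fin n → ℝ) → ℝ)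
    (_ : BlockDecomp n p' s' α' f c rr g), ENNReal.ofReal (∑' j, |c j|)

/-- The fractional integral operator `I_γ`. -/
def fracInt (n : ℕ) (γ : ℝ) (f : (Fin n → ℝ) → ℝ) : (Fin n → ℝ) → ℝ :=
  fun x => ∫ y, f y / Real.sqrt (∑ i, (x i - y i) ^ 2) ^ ((n : ℝ) - γ)

/-- The fractional maximal operator `M_γ`. -/
def fracMax (n : ℕ) (γ : ℝ) (f : (Fin n → ℝ) → ℝ) : (Fin n → ℝ) → ℝ≥0∞ :=
  fun x => ⨆ (y : Fin n → ℝ) (r : ℝ) (_ : 0 < r) (_ : x ∈ eball n y r),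
    volume (eball n y r) ^ (γ / (n : ℝ) - 1) * ∫⁻ z in eball n y r, (‖f z‖₊ : ℝ≥0∞)

/-- The commutator `[b, I_γ] f`. -/
def commFracInt (n : ℕ) (γ : ℝ) (b f : (Fin n → ℝ) → ℝ) : (Fin n → ℝ) → ℝ :=
  fun x => ∫ y, (b x - b y) * f y / Real.sqrt (∑ i, (x i - y i) ^ 2) ^ ((n : ℝ) - γ)

/-- The mean value `b_B` of `b` over the ball `B(y,r)`. -/
def ballAvg (n : ℕ) (b : (Fin n → ℝ) → ℝ) (y : Fin n → ℝ) (r : ℝ) : ℝ :=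
  (volume (eball n y r)).toReal⁻¹ * ∫ x in eball n y r, b x

/-- The `BMO` norm `sup_B (1/|B|) ∫_B |b - b_B|`. -/
def bmoNorm (n : ℕ) (b : (Fin n → ℝ) → ℝ) : ℝ≥0∞ :=
  ⨆ (y : Fin n → ℝ) (r : ℝ) (_ : 0 < r),
    ENNReal.ofReal
      ((volume (eball n y r)).toReal⁻¹ * ∫ x in eball n y r, |b x - ballAvg n b y r|)

lemma invSum_succ (n : ℕ) (p : Fin (n+1) → ℝ≥0∞) :
    invSum (n+1) p = invSum n (fun i => p i.castSucc) + (1 / p (Fin.last n)).toReal := by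
  simp [invSum, Fin.sum_univ_castSucc]

lemma lpInt_mono (p : ℝ≥0∞) {g h : ℝ → ℝ≥0∞} (H : ∀ t, g t ≤ h t) : lpInt p g ≤ lpInt p h := by
  unfold lpInt
  split_ifs
  · exact essSup_mono_ae (Eventually.of_forall H)
  · gcongr with t
    exact H t

lemma mixedE_mono (n : ℕ) : ∀ (p : Fin n → ℝ≥0∞) {g h : (Fin n → ℝ) → ℝ≥0∞},
    (∀ x, g x ≤ h x) → mixedE n p g ≤ mixedE n p h := by
  induction n with
  | zero => intro p g h H; exact H _
  | succ n ih => intro p g h H; exact lpInt_mono _ fun t => ih _ fun x => H _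

lemma lpInt_le (p : ℝ≥0∞) (hp : 1 ≤ p) (a L : ℝ) (c : ℝ≥0∞) (g : ℝ → ℝ≥0∞)
    (h1 : ∀ t, g t ≤ c) (h2 : ∀ t, t ∉ Icc a (a + L) → g t = 0) :
    lpInt p g ≤ c * ENNReal.ofReal L ^ (1 / p).toReal := by
  unfold lpInt
  split_ifs with h
  · subst h
    simp only [one_div, inv_top, toReal_zero, rpow_zero, mul_one]
    exact essSup_le_of_ae_le _ (Eventually.of_forall h1)
  · have hp0 : 0 < p.toReal := toReal_pos (by positivity) h
    have : (1 / p).toReal = 1 / p.toReal := by simp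
    rw [this]
    calc (∫⁻ t, g t ^ p.toReal) ^ (1 / p.toReal)
        ≤ (∫⁻ t, (Icc a (a+L)).indicator (fun _ => c ^ p.toReal) t) ^ (1 / p.toReal) := by
          gcongr with t
          by_cases ht : t ∈ Icc a (a+L)
          · simp only [ht, indicator_of_mem]; gcongr; exact h1 t
          · simp [h2 t ht, hp0]
      _ = c * ENNReal.ofReal L ^ (1 / p.toReal) := by
          rw [lintegral_indicator measurableSet_Icc, setLIntegral_const, Real.volume_Icc,
            ENNReal.mul_rpow_of_nonneg _ _ (by positivity), ← ENNReal.rpow_mul,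
            mul_one_div_cancel hp0.ne', rpow_one]
          simp

lemma mixedE_le (n : ℕ) : ∀ (p : Fin n → ℝ≥0∞) (_ : ∀ i, 1 ≤ p i) (a : Fin n → ℝ) (L : ℝ)
    (_ : 0 < L) (c : ℝ≥0∞) (g : (Fin n → ℝ) → ℝ≥0∞) (_ : ∀ x, g x ≤ c)
    (_ : ∀ x, (¬ ∀ i, x i ∈ Icc (a i) (a i + L)) → g x = 0),
    mixedE n p g ≤ c * ENNReal.ofReal L ^ invSum n p := by
  induction n with
  | zero => intro p hp a L hL c g h1 h2; simpa [mixedE, invSum] using h1 _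
  | succ n ih =>
    intro p hp a L hL c g h1 h2
    rw [invSum_succ, ENNReal.rpow_add _ _ (by simpa using hL) (by simp), ← mul_assoc]
    have key : ∀ (c' : ℝ≥0∞) t, (∀ x : Fin n → ℝ, g (Fin.snoc x t) ≤ c') →
      mixedE n (fun i => p i.castSucc) (fun x => g (Fin.snoc x t)) ≤
        c' * ENNReal.ofReal L ^ invSum n (fun i => p i.castSucc) := by
      intro c' t hc
      refine ih _ (fun i => hp _) (fun i => a i.castSucc) L hL c' _ hc ?_
      intro x hx
      apply h2
      intro hh
      exact hx fun i => by simpa using hh i.castSucc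
    apply lpInt_le _ (hp _) (a (Fin.last n)) L
    · intro t; exact key c t fun x => h1 _
    · intro t ht
      have := key 0 t fun x => by
        rw [h2]
        intro hh
        exact ht (by simpa using hh (Fin.last n))
      simpa using this

lemma lpInt_holder (p : ℝ≥0∞) (hp : 1 ≤ p) (a L : ℝ) (g : ℝ → ℝ≥0∞) (hg : Measurable g) :
    ∫⁻ t in Icc a (a + L), g t ≤ ENNReal.ofReal L ^ (1 - (1 / p).toReal) * lpInt p g := by
  have h := eLpNorm_le_eLpNorm_mul_rpow_measure_univ (μ := volume.restrict (Icc a (a+L))) hp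
    (hg.aestronglyMeasurable (μ := volume.restrict (Icc a (a+L))))
  have h2 : eLpNorm g p (volume.restrict (Icc a (a+L))) ≤ lpInt p g := by
    refine (eLpNorm_restrict_le _ _ _ _).trans ?_
    unfold lpInt
    split_ifs with h
    · subst h; simp [eLpNormEssSup]
    · rw [eLpNorm_eq_lintegral_rpow_enorm_toReal (by positivity) h]; simp
  rw [eLpNorm_one_eq_lintegral_enorm] at h
  simp only [enorm_eq_self, Measure.restrict_apply_univ, Real.volume_Icc, toReal_one, div_one] at h
  rw [mul_comm]
  have e : (1 / p).toReal = 1 / p.toReal := by simp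
  rw [e]
  refine h.trans ?_
  simp only [add_sub_cancel_left]
  gcongr

def cube (n : ℕ) (a : Fin n → ℝ) (L : ℝ) : Set (Fin n → ℝ) := {x | ∀ i, x i ∈ Icc (a i) (a i + L)}

lemma cube_eq (n : ℕ) (a : Fin n → ℝ) (L : ℝ) : cube n a L = Icc a (a + fun _ => L) := by
  ext x; simp [cube, Pi.le_def, forall_and]

lemma measurableSet_cube (n : ℕ) (a : Fin n → ℝ) (L : ℝ) : MeasurableSet (cube n a L) := by
  rw [cube_eq]; exact measurableSet_Icc

lemma volume_cube (n : ℕ) (a : Fin n → ℝ) (L : ℝ) :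
    volume (cube n a L) = ENNReal.ofReal L ^ n := by
  rw [cube_eq, Real.volume_Icc_pi]; simp

lemma meas_snoc (n : ℕ) : Measurable fun q : ℝ × (Fin n → ℝ) => (Fin.snoc q.2 q.1 : Fin (n+1) → ℝ) := by
  have := (MeasurableEquiv.piFinSuccAbove (fun _ : Fin (n+1) => ℝ) (Fin.last n)).symm.measurable
  convert this using 2 with q
  simp [MeasurableEquiv.piFinSuccAbove, Fin.insertNthEquiv, Fin.insertNth_last']

lemma lintegral_snoc (n : ℕ) (g : (Fin (n+1) → ℝ) → ℝ≥0∞) (hg : Measurable g) :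
    ∫⁻ x, g x = ∫⁻ t : ℝ, ∫⁻ x : Fin n → ℝ, g (Fin.snoc x t) := by
  have mp := volume_preserving_piFinSuccAbove (fun _ : Fin (n+1) => ℝ) (Fin.last n)
  have mp' := mp.symm
  rw [← mp'.lintegral_comp hg, Measure.volume_eq_prod, lintegral_prod]
  · congr! with t x
    simp [MeasurableEquiv.piFinSuccAbove, Fin.insertNthEquiv, Fin.insertNth_last']
  · exact (hg.comp (MeasurableEquiv.measurable _)).aemeasurable

lemma mixedE_holder (n : ℕ) : ∀ (p : Fin n → ℝ≥0∞) (_ : ∀ i, 1 ≤ p i) (a : Fin n → ℝ) (L : ℝ)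
    (_ : 0 < L) (g : (Fin n → ℝ) → ℝ≥0∞) (_ : Measurable g),
    ∫⁻ x in cube n a L, g x ≤ ENNReal.ofReal L ^ (n - invSum n p) * mixedE n p g := by
  induction n with
  | zero =>
    intro p hp a L hL g hg
    have : cube 0 a L = univ := by ext; simp [cube]
    rw [this]
    simp [mixedE, invSum]
    rw [Measure.volume_pi_eq_dirac Fin.elim0]
    simp
  | succ n ih =>
    intro p hp a L hL g hg
    have hL0 : ENNReal.ofReal L ≠ 0 := by simpa using hL
    set C := ENNReal.ofReal L ^ ((n:ℝ) - invSum n (fun i => p i.castSucc)) with hC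
    have hC0 : C ≠ 0 := by simp [hC, ENNReal.rpow_eq_zero_iff, hL.not_ge]
    have hCt : C ≠ ∞ := by simp [hC, ENNReal.rpow_eq_top_iff, hL.not_ge]
    set a' := fun i : Fin n => a i.castSucc
    have hm2 : Measurable fun q : ℝ × (Fin n → ℝ) => g (Fin.snoc q.2 q.1) := hg.comp (meas_snoc n)
    set F : ℝ → ℝ≥0∞ := fun t => ∫⁻ x in cube n a' L, g (Fin.snoc x t) with hF
    have hFm : Measurable F := hm2.lintegral_prod_right'
    have step1 : ∫⁻ x in cube (n+1) a L, g x = ∫⁻ t in Icc (a (Fin.last n)) (a (Fin.last n) + L), F t := by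
      rw [← lintegral_indicator (measurableSet_cube _ _ _), lintegral_snoc _ _ (hg.indicator (measurableSet_cube _ _ _)),
        ← lintegral_indicator measurableSet_Icc]
      congr! with t
      by_cases ht : t ∈ Icc (a (Fin.last n)) (a (Fin.last n) + L)
      · rw [indicator_of_mem ht, hF]
        dsimp only
        rw [← lintegral_indicator (measurableSet_cube _ _ _)]
        congr! with x
        simp only [indicator]
        congr 1
        simp [cube, Fin.forall_fin_succ', a']
        intro _; exact ht
      · rw [indicator_of_notMem ht, lintegral_eq_zero_of_ae_eq_zero]
        refine Eventually.of_forall fun x => ?_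
        simp only [Pi.zero_apply, indicator_apply_eq_zero]
        intro hx
        exact absurd (by simpa using hx (Fin.last n)) ht
    rw [step1]
    have e : ((n + 1 : ℕ) : ℝ) - invSum (n+1) p = ((n:ℝ) - invSum n (fun i => p i.castSucc)) + (1 - (1 / p (Fin.last n)).toReal) := by
      rw [invSum_succ]; push_cast; ring
    rw [e, ENNReal.rpow_add _ _ hL0 (by simp), ← hC]
    have step2 : lpInt (p (Fin.last n)) (fun t => C⁻¹ * F t) ≤ mixedE (n+1) p g := by
      refine lpInt_mono _ fun t => ?_
      rw [ENNReal.inv_mul_le_iff hC0 hCt]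
      exact ih _ (fun i => hp _) a' L hL _ (hm2.comp measurable_prodMk_left)
    have step3 := lpInt_holder (p (Fin.last n)) (hp _) (a (Fin.last n)) L (fun t => C⁻¹ * F t) (hFm.const_mul _)
    rw [lintegral_const_mul _ hFm, ENNReal.inv_mul_le_iff hC0 hCt, ← mul_assoc] at step3
    refine step3.trans ?_
    gcongr

def VB (n : ℕ) : ℝ≥0∞ := ENNReal.ofReal (√Real.pi ^ n / Real.Gamma (n / 2 + 1))

lemma VB_ne_zero (n : ℕ) : VB n ≠ 0 := by
  have : 0 < Real.Gamma ((n:ℝ) / 2 + 1) := Real.Gamma_pos_of_pos (by positivity)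
  have : 0 < √Real.pi ^ n / Real.Gamma ((n:ℝ) / 2 + 1) := by positivity
  simpa [VB] using this

lemma VB_ne_top (n : ℕ) : VB n ≠ ∞ := by simp [VB]

lemma eball_eq (n : ℕ) (y : Fin n → ℝ) (r : ℝ) :
    eball n y r = (WithLp.toLp 2) ⁻¹' (Metric.ball (WithLp.toLp 2 y : EuclideanSpace ℝ (Fin n)) r) := by
  ext x
  simp [eball, EuclideanSpace.dist_eq, Real.dist_eq, sq_abs]

lemma volume_eball (n : ℕ) (hn : 1 ≤ n) (y : Fin n → ℝ) (r : ℝ) :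
    volume (eball n y r) = VB n * ENNReal.ofReal r ^ n := by
  have : Nonempty (Fin n) := ⟨⟨0, hn⟩⟩
  rw [eball_eq, (PiLp.volume_preserving_toLp (Fin n)).measure_preimage
      Metric.isOpen_ball.measurableSet.nullMeasurableSet, EuclideanSpace.volume_ball]
  simp [VB, mul_comm]

lemma vol_rpow (n : ℕ) (hn : 1 ≤ n) (y : Fin n → ℝ) (r : ℝ) (e : ℝ) :
    volume (eball n y r) ^ e = VB n ^ e * ENNReal.ofReal r ^ ((n:ℝ) * e) := by
  rw [volume_eball n hn, ENNReal.mul_rpow_of_ne_top (VB_ne_top n) (by simp), ENNReal.rpow_mul,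
    ENNReal.rpow_natCast]

lemma eball_abs {n : ℕ} {x y : Fin n → ℝ} {r : ℝ} (h : x ∈ eball n y r) (i : Fin n) :
    |x i - y i| < r := by
  refine lt_of_le_of_lt ?_ h
  apply Real.abs_le_sqrt
  exact Finset.single_le_sum (f := fun i => (x i - y i)^2) (fun i _ => sq_nonneg _) (Finset.mem_univ i)

lemma mem_eball_of {n : ℕ} {x y : Fin n → ℝ} {r d : ℝ} (hr : 0 < r) (hd : 0 ≤ d) (hn : 1 ≤ n)
    (hdr : n * d < r) (h : ∀ i, |x i - y i| ≤ d) : x ∈ eball n y r := by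
  unfold eball
  rw [mem_ofPred_eq, Real.sqrt_lt' hr]
  have hn' : (1:ℝ) ≤ n := by exact_mod_cast hn
  calc ∑ i, (x i - y i)^2 ≤ ∑ i : Fin n, d^2 := by
        refine Finset.sum_le_sum fun i _ => ?_
        exact sq_le_sq.2 ((h i).trans (le_abs_self d))
    _ = n * d^2 := by simp
    _ ≤ (n * d)^2 := by nlinarith [sq_nonneg d]
    _ < r^2 := by gcongr

lemma eball_symm {n : ℕ} {x y : Fin n → ℝ} {r : ℝ} : x ∈ eball n y r ↔ y ∈ eball n x r := by
  unfold eball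
  simp only [mem_ofPred_eq]
  have : ∀ i, (x i - y i)^2 = (y i - x i)^2 := fun i => by ring
  simp [this]

lemma eball_meas2 (n : ℕ) (r : ℝ) :
    MeasurableSet {q : (Fin n → ℝ) × (Fin n → ℝ) | q.2 ∈ eball n q.1 r} := by
  unfold eball
  simp only [mem_ofPred_eq]
  apply measurableSet_lt <;> fun_prop

lemma eball_meas (n : ℕ) (y : Fin n → ℝ) (r : ℝ) : MeasurableSet (eball n y r) := by
  unfold eball
  apply measurableSet_lt <;> fun_prop

lemma growth (K M : ℝ≥0∞) (hK : K ≠ 0) (hM : M ≠ ∞) (δ R : ℝ) (hδ : 0 < δ)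
    (h : ∀ t, R ≤ t → K * ENNReal.ofReal t ^ δ ≤ M) : False := by
  set A := (M / K) ^ (1/δ) with hA
  have hAt : A ≠ ∞ := ENNReal.rpow_ne_top_of_nonneg (by positivity) (ENNReal.div_ne_top hM hK)
  have hKt : K ≠ ∞ := by
    rintro rfl
    have := h (max R 1) (le_max_left _ _)
    rw [ENNReal.top_mul] at this
    · exact hM (top_le_iff.1 this)
    · have : 0 < max R 1 := by positivity
      simp [ENNReal.rpow_eq_zero_iff, hδ]
  have h1 := h (max R (A.toReal + 1)) (le_max_left _ _)
  rw [mul_comm, ← ENNReal.le_div_iff_mul_le (Or.inl hK) (Or.inl hKt)] at h1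
  have h2 : ENNReal.ofReal (max R (A.toReal + 1)) ≤ A := by
    rw [hA, ← ENNReal.rpow_le_rpow_iff hδ, ← ENNReal.rpow_mul, one_div_mul_cancel hδ.ne', rpow_one]
    exact h1
  rw [ENNReal.ofReal_le_iff_le_toReal hAt] at h2
  linarith [le_max_right R (A.toReal + 1)]

lemma mixedLp_ge (n : ℕ) (p : Fin n → ℝ≥0∞) (f : (Fin n → ℝ) → ℝ) (g : (Fin n → ℝ) → ℝ≥0∞)
    (hgf : ∀ x, g x ≤ (‖f x‖₊ : ℝ≥0∞)) (A B : Set (Fin n → ℝ)) (hAB : A ⊆ B) :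
    mixedE n p (A.indicator g) ≤ mixedLp n p (B.indicator f) := by
  apply mixedE_mono
  intro x
  by_cases hx : x ∈ A
  · simp [hx, hAB hx, hgf x]
  · simp [hx]

lemma ofReal_rpow_cancel {r : ℝ} (hr : 0 < r) (a : ℝ) :
    ENNReal.ofReal r ^ a ≠ 0 ∧ ENNReal.ofReal r ^ a ≠ ∞ := by
  constructor <;> simp [ENNReal.rpow_eq_zero_iff, ENNReal.rpow_eq_top_iff, hr.not_ge]

lemma upper (n : ℕ) (hn : 1 ≤ n) (p s : Fin n → ℝ≥0∞) (α : ℝ≥0∞)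
    (hp : ∀ i, 1 ≤ p i) (hs : ∀ i, 1 ≤ s i)
    (h1 : invSum n s / (n : ℝ) ≤ (1 / α).toReal) (h2 : (1 / α).toReal ≤ invSum n p / (n : ℝ)) :
    ∃ f : (Fin n → ℝ) → ℝ, memA n p s α f ∧ ¬ f =ᵐ[volume] 0 := by
  have hn0 : (0:ℝ) < n := by exact_mod_cast hn
  set Q := cube n 0 1
  have hQ : volume Q = 1 := by simp [Q, volume_cube]
  refine ⟨Q.indicator 1, ⟨?_, ?_⟩, ?_⟩
  · apply Integrable.locallyIntegrable
    apply IntegrableOn.integrable_indicator _ (measurableSet_cube _ _ _)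
    exact integrableOn_const (by rw [hQ]; simp) (by simp)
  · set e := (1 / α).toReal - invSum n p / (n : ℝ) - invSum n s / (n : ℝ) with he
    set P := invSum n p with hP
    set S := invSum n s with hS
    have hP0 : 0 ≤ P := Finset.sum_nonneg fun i _ => toReal_nonneg
    have hS0 : 0 ≤ S := Finset.sum_nonneg fun i _ => toReal_nonneg
    have hVt : VB n ^ e ≠ ∞ := by simp [ENNReal.rpow_eq_top_iff, VB_ne_zero, VB_ne_top]
    have h2P : (2:ℝ≥0∞) ^ P ≠ ∞ := ENNReal.rpow_ne_top_of_nonneg hP0 (by simp)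
    have h3S : (3:ℝ≥0∞) ^ S ≠ ∞ := ENNReal.rpow_ne_top_of_nonneg hS0 (by simp)
    refine lt_of_le_of_lt (b := VB n ^ e * 2 ^ P * 3 ^ S) ?_
      (ENNReal.mul_lt_top (ENNReal.mul_lt_top hVt.lt_top h2P.lt_top) h3S.lt_top)
    refine iSup₂_le fun r hr => ?_
    -- generic estimate
    have gen : ∀ K : ℝ≥0∞, (∀ y, mixedLp n p ((eball n y r).indicator (Q.indicator 1)) ≤ K) →
        (mixedE n s fun y => volume (eball n y r) ^ e *
          mixedLp n p ((eball n y r).indicator (Q.indicator 1))) ≤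
        VB n ^ e * ENNReal.ofReal r ^ ((n:ℝ) * e) * K * ENNReal.ofReal (1 + 2 * r) ^ S := by
      intro K hK
      refine mixedE_le n s hs (fun _ => -r) (1 + 2 * r) (by positivity) _ _ ?_ ?_
      · intro y
        rw [vol_rpow n hn]
        gcongr
        exact hK y
      · intro y hy
        have : (eball n y r).indicator (Q.indicator (1 : (Fin n → ℝ) → ℝ)) = 0 := by
          funext x
          simp only [indicator_indicator, Pi.zero_apply]
          apply indicator_of_notMem
          rintro ⟨hx1, hx2⟩
          apply hy
          intro i
          have h3 := abs_lt.1 (eball_abs hx1 i)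
          have h4 := hx2 i
          simp only [Pi.zero_apply, zero_add, mem_Icc] at h4
          constructor <;> linarith
        rw [this]
        have h0 : mixedLp n p 0 = 0 := by
          have := mixedE_le n p hp 0 1 one_pos 0 (fun x => (‖(0 : (Fin n → ℝ) → ℝ) x‖₊ : ℝ≥0∞))
            (by simp) (by simp)
          simpa [mixedLp] using this
        rw [h0, mul_zero]
    have hle1 : ∀ (A : Set (Fin n → ℝ)) x, (‖A.indicator (Q.indicator (1 : (Fin n → ℝ) → ℝ)) x‖₊ : ℝ≥0∞) ≤ 1 := by
      intro A x
      by_cases hA : x ∈ A <;> by_cases hx : x ∈ Q <;> simp [hA, hx]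
    have hr0 : ENNReal.ofReal r ≠ 0 := by simpa using hr
    rcases le_total 1 r with hr1 | hr1
    · refine (gen 1 fun y => ?_).trans ?_
      · have := mixedE_le n p hp 0 1 one_pos 1
          (fun x => (‖(eball n y r).indicator (Q.indicator (1 : (Fin n → ℝ) → ℝ)) x‖₊ : ℝ≥0∞))
            (hle1 _) (by
              intro x hx
              have : x ∉ Q := hx
              simp [this])
        simpa [mixedLp] using this
      · have e1 : ENNReal.ofReal (1 + 2 * r) ^ S ≤ 3 ^ S * ENNReal.ofReal r ^ S := by
          rw [← ENNReal.mul_rpow_of_nonneg _ _ hS0]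
          gcongr
          rw [show (3:ℝ≥0∞) = ENNReal.ofReal 3 by simp, ← ENNReal.ofReal_mul (by norm_num)]
          apply ENNReal.ofReal_le_ofReal; linarith
        have e2 : ENNReal.ofReal r ^ ((n:ℝ) * e) * ENNReal.ofReal r ^ S ≤ 1 := by
          rw [← ENNReal.rpow_add _ _ hr0 (by simp)]
          have hz : (n:ℝ) * e + S ≤ 0 := by
            rw [le_div_iff₀ hn0] at h2
            rw [he]; field_simp; linarith
          rcases hz.lt_or_eq with hz | hz
          · exact ENNReal.rpow_le_one_of_one_le_of_neg (by simpa using hr1) hz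
          · rw [hz]; simp
        have e3 : (1:ℝ≥0∞) ≤ 2 ^ P := by
          rw [← ENNReal.one_rpow P]; gcongr; norm_num
        calc _ ≤ VB n ^ e * ENNReal.ofReal r ^ ((n:ℝ) * e) * 1 * (3 ^ S * ENNReal.ofReal r ^ S) := by
              gcongr
          _ = VB n ^ e * (ENNReal.ofReal r ^ ((n:ℝ) * e) * ENNReal.ofReal r ^ S) * 3 ^ S := by ring
          _ ≤ VB n ^ e * 2 ^ P * 3 ^ S := by gcongr; exact e2.trans e3
    · refine (gen (2 ^ P * ENNReal.ofReal r ^ P) fun y => ?_).trans ?_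
      · have := mixedE_le n p hp (fun i => y i - r) (2 * r) (by positivity) 1
          (fun x => (‖(eball n y r).indicator (Q.indicator (1 : (Fin n → ℝ) → ℝ)) x‖₊ : ℝ≥0∞))
            (hle1 _) (by
              intro x hx
              have : x ∉ eball n y r := by
                intro h
                apply hx
                intro i
                have h3 := abs_lt.1 (eball_abs h i)
                constructor <;> linarith
              simp [this])
        rw [← ENNReal.mul_rpow_of_nonneg _ _ hP0]
        rw [ENNReal.ofReal_mul (by norm_num)] at this
        simpa [mixedLp] using this
      · have e1 : ENNReal.ofReal (1 + 2 * r) ^ S ≤ 3 ^ S := by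
          gcongr
          rw [show (3:ℝ≥0∞) = ENNReal.ofReal 3 by simp]
          apply ENNReal.ofReal_le_ofReal; linarith
        have e2 : ENNReal.ofReal r ^ ((n:ℝ) * e) * ENNReal.ofReal r ^ P ≤ 1 := by
          rw [← ENNReal.rpow_add _ _ hr0 (by simp)]
          apply ENNReal.rpow_le_one (by simpa using hr1)
          rw [div_le_iff₀ hn0] at h1
          rw [he]; field_simp; linarith
        calc _ ≤ VB n ^ e * ENNReal.ofReal r ^ ((n:ℝ) * e) * (2 ^ P * ENNReal.ofReal r ^ P) * 3 ^ S := by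
              gcongr
          _ = VB n ^ e * (ENNReal.ofReal r ^ ((n:ℝ) * e) * ENNReal.ofReal r ^ P) * 2 ^ P * 3 ^ S := by ring
          _ ≤ VB n ^ e * 1 * 2 ^ P * 3 ^ S := by gcongr
          _ = _ := by rw [mul_one]
  · intro h
    have : volume Q = 0 := by
      refine measure_mono_null ?_ h
      intro x hx
      simp [hx]
    rw [hQ] at this
    exact one_ne_zero this

lemma case1 (n : ℕ) (hn : 1 ≤ n) (p s : Fin n → ℝ≥0∞) (α : ℝ≥0∞)
    (hp : ∀ i, 1 ≤ p i) (hs : ∀ i, 1 ≤ s i) (f : (Fin n → ℝ) → ℝ) (g : (Fin n → ℝ) → ℝ≥0∞)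
    (hg : Measurable g) (hgf : ∀ x, g x ≤ (‖f x‖₊ : ℝ≥0∞)) (R : ℝ) (hR : 0 < R)
    (hc : ∫⁻ x in cube n (fun _ => -R) (2 * R), g x ≠ 0)
    (hM : amalgamNormA n p s α f ≠ ∞) : (1 / α).toReal ≤ invSum n p / (n : ℝ) := by
  by_contra! hlt
  have hn0 : (0:ℝ) < n := by exact_mod_cast hn
  set Q := cube n (fun _ => -R) (2 * R) with hQ
  have hQm : MeasurableSet Q := measurableSet_cube _ _ _
  set e := (1 / α).toReal - invSum n p / (n : ℝ) - invSum n s / (n : ℝ) with he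
  set P := invSum n p with hP
  set S := invSum n s with hS
  set c := mixedE n p (Q.indicator g) with hcdef
  have hc0 : c ≠ 0 := by
    intro h
    have := mixedE_holder n p hp (fun _ => -R) (2 * R) (by positivity) (Q.indicator g)
      (hg.indicator hQm)
    rw [← hcdef, h, mul_zero, ← hQ, setLIntegral_indicator hQm, inter_self] at this
    exact hc (le_antisymm this (by simp))
  have hV0 : VB n ^ e ≠ 0 := by simp [ENNReal.rpow_eq_zero_iff, VB_ne_zero, VB_ne_top]
  have hk : (0:ℝ) < 1 / (2 * n) := by positivity
  refine growth (VB n ^ e * c * ENNReal.ofReal (1 / (2 * n)) ^ S) _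
    (mul_ne_zero (mul_ne_zero hV0 hc0) (ofReal_rpow_cancel hk S).1) hM ((1 / α).toReal * n - P) (4 * n * R) ?_ ?_
  · rw [div_lt_iff₀ hn0] at hlt; linarith
  intro r hr
  have hr0 : 0 < r := lt_of_lt_of_le (by positivity) hr
  have hr00 : ENNReal.ofReal r ≠ 0 := by simpa using hr0
  set L := r * (1 / (2 * n)) with hL
  have hL0 : 0 < L := by positivity
  have hnL : n * L = r / 2 := by rw [hL]; field_simp
  have hRL : R ≤ L / 2 := by
    rw [hL, le_div_iff₀ two_pos, mul_one_div, le_div_iff₀ (by positivity)]; linarith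
  set T := cube n (fun _ => -(L/2)) L with hT
  have hTm : MeasurableSet T := measurableSet_cube _ _ _
  set w := VB n ^ e * ENNReal.ofReal r ^ ((n:ℝ) * e) * c with hw
  have key : mixedE n s (T.indicator fun _ => w) ≤ amalgamNormA n p s α f := by
    refine le_trans ?_ (le_iSup₂ (f := fun (r : ℝ) (_ : 0 < r) => mixedE n s fun y =>
      volume (eball n y r) ^ e * mixedLp n p ((eball n y r).indicator f)) r hr0)
    apply mixedE_mono
    intro y
    by_cases hy : y ∈ T
    · simp only [hy, indicator_of_mem]
      rw [vol_rpow n hn, hw]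
      gcongr
      apply mixedLp_ge n p f g hgf
      intro x hx
      refine mem_eball_of (d := L) hr0 hL0.le hn (by linarith) fun i => ?_
      have h1 := hx i
      have h2 := hy i
      simp only [mem_Icc] at h1 h2
      rw [abs_le]
      constructor <;> linarith
    · simp [hy]
  have hol := mixedE_holder n s hs (fun _ => -(L/2)) L hL0 (T.indicator fun _ => w)
    (measurable_const.indicator hTm)
  rw [← hT, setLIntegral_indicator hTm, inter_self, setLIntegral_const, hT, volume_cube, ← hT] at hol
  have hsplit : ENNReal.ofReal L ^ n = ENNReal.ofReal L ^ (n - S) * ENNReal.ofReal L ^ S := by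
    rw [← ENNReal.rpow_add _ _ (by simpa using hL0) (by simp), ← ENNReal.rpow_natCast]
    congr 1; ring
  rw [hsplit, mul_left_comm] at hol
  obtain ⟨ha, hb⟩ := ofReal_rpow_cancel hL0 (n - S)
  rw [ENNReal.mul_le_mul_iff_right ha hb] at hol
  refine le_trans (le_of_eq ?_) (hol.trans key)
  have : (1 / α).toReal * n - P = n * e + S := by rw [he]; field_simp; ring
  rw [this, ENNReal.rpow_add _ _ hr00 (by simp), hw, hL, ENNReal.ofReal_mul hr0.le,
    ENNReal.mul_rpow_of_ne_top ofReal_ne_top ofReal_ne_top]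
  ring

lemma case2 (n : ℕ) (hn : 1 ≤ n) (p s : Fin n → ℝ≥0∞) (α : ℝ≥0∞)
    (hp : ∀ i, 1 ≤ p i) (hs : ∀ i, 1 ≤ s i) (f : (Fin n → ℝ) → ℝ) (g : (Fin n → ℝ) → ℝ≥0∞)
    (hg : Measurable g) (hgf : ∀ x, g x ≤ (‖f x‖₊ : ℝ≥0∞)) (R : ℝ) (hR : 0 < R)
    (hc : ∫⁻ x in cube n (fun _ => -R) (2 * R), g x ≠ 0)
    (hM : amalgamNormA n p s α f ≠ ∞) : invSum n s / (n : ℝ) ≤ (1 / α).toReal := by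
  by_contra! hlt
  have hn0 : (0:ℝ) < n := by exact_mod_cast hn
  set Q := cube n (fun _ => -R) (2 * R) with hQ
  have hQm : MeasurableSet Q := measurableSet_cube _ _ _
  set e := (1 / α).toReal - invSum n p / (n : ℝ) - invSum n s / (n : ℝ) with he
  set P := invSum n p with hP
  set S := invSum n s with hS
  set c := ∫⁻ x in Q, g x with hcdef
  have hV0 : VB n ^ e ≠ 0 := by simp [ENNReal.rpow_eq_zero_iff, VB_ne_zero, VB_ne_top]
  set T := cube n (fun _ => -(R+1)) (2 * (R+1)) with hT
  have hTm : MeasurableSet T := measurableSet_cube _ _ _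
  set B := ENNReal.ofReal (2 * (R+1)) ^ (n - S) with hB
  have hBt : B ≠ ∞ := (ofReal_rpow_cancel (by positivity) _).2
  have h2P : (2:ℝ≥0∞) ^ (P - n) ≠ 0 := by simp [ENNReal.rpow_eq_zero_iff]
  refine growth (VB n ^ e * 2 ^ (P - n) * VB n * c) (B * amalgamNormA n p s α f)
    (mul_ne_zero (mul_ne_zero (mul_ne_zero hV0 h2P) (VB_ne_zero n)) hc) (ENNReal.mul_ne_top hBt hM)
    (S - (1 / α).toReal * n) 1 ?_ ?_
  · rw [lt_div_iff₀ hn0] at hlt; linarith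
  intro t ht
  have ht0 : 0 < t := by linarith
  set r := t⁻¹ with hr
  have hr0 : 0 < r := by positivity
  have hr1 : r ≤ 1 := inv_le_one_of_one_le₀ ht
  have hr00 : ENNReal.ofReal r ≠ 0 := by simpa using hr0
  have htr : ENNReal.ofReal t = (ENNReal.ofReal r)⁻¹ := by
    rw [hr, ENNReal.ofReal_inv_of_pos ht0, inv_inv]
  set G : (Fin n → ℝ) → ℝ≥0∞ := fun y => ∫⁻ x in eball n y r, g x with hG
  have hG' : ∀ y, G y = ∫⁻ x, {q : (Fin n → ℝ) × (Fin n → ℝ) | q.2 ∈ eball n q.1 r}.indicator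
      (fun q => g q.2) (y, x) := by
    intro y
    rw [hG]; dsimp only
    rw [← lintegral_indicator (eball_meas n y r)]
    rfl
  have hm2 : Measurable ({q : (Fin n → ℝ) × (Fin n → ℝ) | q.2 ∈ eball n q.1 r}.indicator
      (fun q => g q.2)) := (hg.comp measurable_snd).indicator (eball_meas2 n r)
  have hGm : Measurable G := by
    rw [funext hG']
    exact hm2.lintegral_prod_right'
  set w := VB n ^ e * ENNReal.ofReal r ^ ((n:ℝ) * e) * ENNReal.ofReal (2 * r) ^ (P - n) with hw
  have key : mixedE n s (fun y => w * G y) ≤ amalgamNormA n p s α f := by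
    refine le_trans ?_ (le_iSup₂ (f := fun (r : ℝ) (_ : 0 < r) => mixedE n s fun y =>
      volume (eball n y r) ^ e * mixedLp n p ((eball n y r).indicator f)) r hr0)
    apply mixedE_mono
    intro y
    rw [vol_rpow n hn, hw, mul_assoc (VB n ^ e * _)]
    gcongr
    have h1 := mixedLp_ge n p f g hgf (eball n y r) (eball n y r) subset_rfl
    refine le_trans ?_ h1
    have h2 := mixedE_holder n p hp (fun i => y i - r) (2 * r) (by positivity)
      ((eball n y r).indicator g) (hg.indicator (eball_meas n y r))
    have hsub : eball n y r ⊆ cube n (fun i => y i - r) (2 * r) := by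
      intro x hx i
      have h3 := abs_lt.1 (eball_abs hx i)
      constructor <;> linarith
    rw [setLIntegral_indicator (eball_meas n y r), inter_eq_self_of_subset_left hsub] at h2
    obtain ⟨ha, hb⟩ := ofReal_rpow_cancel (r := 2 * r) (by positivity) (n - P)
    rw [← ENNReal.inv_mul_le_iff ha hb, ← ENNReal.rpow_neg, neg_sub] at h2
    exact h2
  have hol := mixedE_holder n s hs (fun _ => -(R+1)) (2 * (R+1)) (by positivity) (fun y => w * G y)
    (hGm.const_mul _)
  rw [lintegral_const_mul _ hGm] at hol
  have fub : VB n * ENNReal.ofReal r ^ n * c ≤ ∫⁻ y in T, G y := by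
    simp_rw [hG']
    rw [lintegral_lintegral_swap (f := fun y x =>
      {q : (Fin n → ℝ) × (Fin n → ℝ) | q.2 ∈ eball n q.1 r}.indicator (fun q => g q.2) (y, x))
      hm2.aemeasurable]
    calc VB n * ENNReal.ofReal r ^ n * c = ∫⁻ x in Q, VB n * ENNReal.ofReal r ^ n * g x := by
          rw [lintegral_const_mul _ hg]
      _ ≤ ∫⁻ x in Q, ∫⁻ y in T, {q : (Fin n → ℝ) × (Fin n → ℝ) | q.2 ∈ eball n q.1 r}.indicator
            (fun q => g q.2) (y, x) := by
          apply setLIntegral_mono' hQm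
          intro x hx
          have hsub : eball n x r ⊆ T := by
            intro y hy i
            have h3 := abs_lt.1 (eball_abs hy i)
            have h4 := hx i
            simp only [mem_Icc] at h4
            constructor <;> linarith
          have : ∀ y, {q : (Fin n → ℝ) × (Fin n → ℝ) | q.2 ∈ eball n q.1 r}.indicator
            (fun q => g q.2) (y, x) = (eball n x r).indicator (fun _ => g x) y := by
            intro y
            simp only [indicator]
            congr 1
            exact propext eball_symm
          simp_rw [this]
          rw [setLIntegral_indicator (eball_meas n x r), inter_eq_self_of_subset_left hsub,
            setLIntegral_const, volume_eball n hn, mul_comm]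
      _ ≤ _ := setLIntegral_le_lintegral _ _
  calc VB n ^ e * 2 ^ (P - n) * VB n * c * ENNReal.ofReal t ^ (S - (1 / α).toReal * n)
      = w * (VB n * ENNReal.ofReal r ^ n * c) := by
        have hexp : -(S - (1 / α).toReal * n) = n * e + (P - n) + n := by
          rw [he]; field_simp; ring
        rw [htr, ENNReal.inv_rpow, ← ENNReal.rpow_neg, hexp, ENNReal.rpow_add _ _ hr00 (by simp),
          ENNReal.rpow_add _ _ hr00 (by simp), hw, ENNReal.ofReal_mul (by norm_num),
          ENNReal.mul_rpow_of_ne_top (by simp) (by simp), ENNReal.rpow_natCast]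
        simp only [ENNReal.ofReal_ofNat]
        ring
    _ ≤ w * ∫⁻ y in T, G y := by gcongr
    _ ≤ B * mixedE n s (fun y => w * G y) := hol
    _ ≤ _ := by gcongr

lemma exists_cube (n : ℕ) (g : (Fin n → ℝ) → ℝ≥0∞) (hg : Measurable g) (h : ∫⁻ x, g x ≠ 0) :
    ∃ R : ℝ, 0 < R ∧ ∫⁻ x in cube n (fun _ => -R) (2 * R), g x ≠ 0 := by
  by_contra! H
  apply h
  have hU : (⋃ k : ℕ, cube n (fun _ => -((k:ℝ)+1)) (2 * ((k:ℝ)+1))) = univ := by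
    rw [eq_univ_iff_forall]
    intro x
    obtain ⟨k, hk⟩ := exists_nat_ge ‖x‖
    refine mem_iUnion.2 ⟨k, fun i => ?_⟩
    have := abs_le.1 ((norm_le_pi_norm x i).trans hk)
    constructor <;> linarith
  rw [← setLIntegral_univ, ← hU]
  refine le_antisymm ((lintegral_iUnion_le _ _).trans ?_) (by simp)
  have hz : ∀ k : ℕ, ∫⁻ x in cube n (fun _ => -((k:ℝ)+1)) (2 * ((k:ℝ)+1)), g x = 0 :=
    fun k => H ((k:ℝ)+1) (by positivity)
  rw [tsum_congr hz, tsum_zero]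

/-- `(L^{p⃗},L^{s⃗})^α(ℝⁿ)` is nontrivial if and only if
`(1/n)Σᵢ 1/sᵢ ≤ 1/α ≤ (1/n)Σᵢ 1/pᵢ`. -/
theorem statement1 (n : ℕ) (hn : 1 ≤ n) (p s : Fin n → ℝ≥0∞) (α : ℝ≥0∞)
    (hp : ∀ i, 1 ≤ p i) (hs : ∀ i, 1 ≤ s i) (hα : 1 ≤ α) :
    (∃ f : (Fin n → ℝ) → ℝ, memA n p s α f ∧ ¬ f =ᵐ[volume] 0) ↔
      (invSum n s / (n : ℝ) ≤ (1 / α).toReal ∧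
        (1 / α).toReal ≤ invSum n p / (n : ℝ)) := by
  constructor
  · rintro ⟨f, ⟨hf, hM⟩, hne⟩
    obtain ⟨g, hg, hgf, hint⟩ := exists_measurable_le_lintegral_eq
      (μ := (volume : Measure (Fin n → ℝ))) (fun x => (‖f x‖₊ : ℝ≥0∞))
    have h0 : ∫⁻ x, g x ≠ 0 := by
      rw [← hint]
      intro h
      change ∫⁻ x, ‖f x‖ₑ = 0 at h
      rw [lintegral_eq_zero_iff' hf.aestronglyMeasurable.enorm] at h
      apply hne
      filter_upwards [h] with x hx
      simpa using hx
    obtain ⟨R, hR, hc⟩ := exists_cube n g hg h0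
    exact ⟨case2 n hn p s α hp hs f g hg hgf R hR hc hM.ne,
      case1 n hn p s α hp hs f g hg hgf R hR hc hM.ne⟩
  · rintro ⟨h1, h2⟩
    exact upper n hn p s α hp hs h1 h2

end MixedAmalgam

end
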